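/- arXiv:2409.19546 — 2 statements merged into one kernel-verified Lean document; each statement's English description precedes it below -/
import Mathlib

section
/- Let b ∈ (4/5, 1], α_n = 1/(n+1)^b, τ_n = Σ_{k=1}^n α_k(1 − α_k), and α_{k,n} = α_k ∏_{j=k+1}^n (1 − α_j). Let {M_n}_{n≥1} be an ℝ^d-valued martingale difference sequence with respect to a filtration (ℱ_n) satisfying E[‖M_n‖₂²] ≤ C² τ_n² for a deterministic constant C. Then the nondecreasing sequence Σ_{k=1}^n α_k ‖Σ_{i=1}^{k−1} α_{i,k−1} M_i‖₂ converges to a finite limit almost surely. -/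
open MeasureTheory Filter

/-- If `X` is `m`-measurable and `Y` has zero conditional expectation given `m`, then `X` and `Y`
are orthogonal in `L²`. -/
theorem integral_inner_eq_zero_of_condExp_eq_zero {Ω E : Type*} {m m0 : MeasurableSpace Ω}
    {μ : Measure Ω} [IsFiniteMeasure μ] [NormedAddCommGroup E] [InnerProductSpace ℝ E]
    [CompleteSpace E] (hm : m ≤ m0) {X Y : Ω → E} (hXm : StronglyMeasurable[m] X)
    (hX : MemLp X 2 μ) (hY : MemLp Y 2 μ) (hXY : μ[Y | m] =ᵐ[μ] 0) :
    Integrable (fun ω => inner ℝ (X ω) (Y ω)) μ ∧ ∫ ω, inner ℝ (X ω) (Y ω) ∂μ = 0 := by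
  have hint : Integrable (fun ω => inner ℝ (X ω) (Y ω)) μ := by
    refine Integrable.mono' (hX.norm.integrable_mul hY.norm) (hX.1.inner hY.1) ?_
    exact ae_of_all _ fun ω => norm_inner_le_norm _ _
  refine ⟨hint, ?_⟩
  have hpull := condExp_bilin_of_stronglyMeasurable_left (innerSL ℝ) hXm hint
    (hY.integrable one_le_two)
  rw [← integral_condExp hm]
  refine integral_eq_zero_of_ae ?_
  filter_upwards [hpull, hXY] with ω h1 h2
  exact h1.trans (by simp [h2])

theorem integral_norm_sq_smul_add_smul_of_condExp_eq_zero {Ω E : Type*}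
    {m m0 : MeasurableSpace Ω} {μ : Measure Ω} [IsFiniteMeasure μ] [NormedAddCommGroup E]
    [InnerProductSpace ℝ E] [CompleteSpace E] (hm : m ≤ m0) {X Y : Ω → E}
    (hXm : StronglyMeasurable[m] X) (hX : MemLp X 2 μ) (hY : MemLp Y 2 μ)
    (hXY : μ[Y | m] =ᵐ[μ] 0) (a c : ℝ) :
    ∫ ω, ‖a • X ω + c • Y ω‖ ^ 2 ∂μ =
      a ^ 2 * ∫ ω, ‖X ω‖ ^ 2 ∂μ + c ^ 2 * ∫ ω, ‖Y ω‖ ^ 2 ∂μ := by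
  obtain ⟨hint, hzero⟩ := integral_inner_eq_zero_of_condExp_eq_zero hm hXm hX hY hXY
  have hexp (ω : Ω) : ‖a • X ω + c • Y ω‖ ^ 2 =
      a ^ 2 * ‖X ω‖ ^ 2 + 2 * a * c * inner ℝ (X ω) (Y ω) + c ^ 2 * ‖Y ω‖ ^ 2 := by
    rw [norm_add_sq_real, norm_smul, norm_smul, real_inner_smul_left, real_inner_smul_right,
      mul_pow, mul_pow, Real.norm_eq_abs, Real.norm_eq_abs, sq_abs, sq_abs]
    ring
  have hX2 := ((memLp_two_iff_integrable_sq_norm hX.1).1 hX).const_mul (a ^ 2)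
  have hY2 := ((memLp_two_iff_integrable_sq_norm hY.1).1 hY).const_mul (c ^ 2)
  have hc := hint.const_mul (2 * a * c)
  simp_rw [hexp]
  rw [integral_add (by exact hX2.add hc) hY2, integral_add hX2 hc, integral_const_mul,
    integral_const_mul, integral_const_mul, hzero]
  ring

theorem ae_summable_norm_of_summable_integral_norm {Ω E : Type*} {m0 : MeasurableSpace Ω}
    {μ : Measure Ω} [NormedAddCommGroup E] {f : ℕ → Ω → E} (hf : ∀ n, Integrable (f n) μ)
    (hsum : Summable fun n => ∫ ω, ‖f n ω‖ ∂μ) : ∀ᵐ ω ∂μ, Summable fun n => ‖f n ω‖ := by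
  refine summable_norm_of_tsum_eLpNorm_ne_top (p := 1) le_rfl (fun n => (hf n).1) ?_
  have h (n : ℕ) : eLpNorm (f n) 1 μ = ENNReal.ofReal (∫ ω, ‖f n ω‖ ∂μ) := by
    rw [eLpNorm_one_eq_lintegral_enorm, ofReal_integral_norm_eq_lintegral_enorm (hf n)]
  simp_rw [h]
  exact hsum.tsum_ofReal_ne_top

/-- `∫ ‖f‖ ≤ r + (∫ ‖f‖²) / r` for every `r > 0`, on a probability space. -/
theorem integral_norm_le_add_integral_norm_sq_div {Ω E : Type*} {m0 : MeasurableSpace Ω}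
    {μ : Measure Ω} [IsProbabilityMeasure μ] [NormedAddCommGroup E] {f : Ω → E}
    (hf : MemLp f 2 μ) {r : ℝ} (hr : 0 < r) :
    ∫ ω, ‖f ω‖ ∂μ ≤ r + (∫ ω, ‖f ω‖ ^ 2 ∂μ) / r := by
  have hsq : Integrable (fun ω => ‖f ω‖ ^ 2) μ := hf.norm.integrable_sq
  calc ∫ ω, ‖f ω‖ ∂μ ≤ ∫ ω, (r + ‖f ω‖ ^ 2 / r) ∂μ := by
        refine integral_mono (hf.integrable one_le_two).norm
          ((integrable_const r).add (hsq.div_const r)) fun ω => ?_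
        have : ‖f ω‖ - (r + ‖f ω‖ ^ 2 / r) = -((‖f ω‖ - r) ^ 2 + ‖f ω‖ * r) / r := by
          field_simp
          ring
        have : -((‖f ω‖ - r) ^ 2 + ‖f ω‖ * r) / r ≤ 0 :=
          div_nonpos_of_nonpos_of_nonneg (neg_nonpos.2 (by positivity)) hr.le
        linarith
    _ = r + (∫ ω, ‖f ω‖ ^ 2 ∂μ) / r := by
        rw [integral_add (integrable_const r) (hsq.div_const r), integral_div]
        simp

theorem sum_Icc_rpow_sub_one_le {s : ℝ} (hs : 0 < s) (hs1 : s ≤ 1) (n : ℕ) :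
    ∑ k ∈ Finset.Icc 1 n, ((k : ℝ) + 1) ^ (s - 1) ≤ ((n : ℝ) + 1) ^ s / s := by
  induction n with
  | zero => simp [hs.le]
  | succ n ih =>
    rw [Finset.sum_Icc_succ_top (by omega)]
    push_cast
    set x : ℝ := (n : ℝ) + 1 with hx
    have hx0 : 0 < x := by positivity
    have hx1 : 0 < x + 1 := by positivity
    have hbern := rpow_one_add_le_one_add_mul_self (s := -(1 / (x + 1)))
      (by rw [neg_le_neg_iff, div_le_one hx1]; linarith) hs.le hs1
    have hfac : x = (x + 1) * (1 + -(1 / (x + 1))) := by field_simp; ring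
    have hpow : x ^ s ≤ (x + 1) ^ s * (1 + s * -(1 / (x + 1))) := by
      conv_lhs => rw [hfac]
      rw [Real.mul_rpow hx1.le (by
        have : 1 / (x + 1) ≤ 1 := by rw [div_le_one hx1]; linarith
        linarith)]
      gcongr
    have hsub : (x + 1) ^ (s - 1) = (x + 1) ^ s / (x + 1) := Real.rpow_sub_one hx1.ne' s
    have : x ^ s / s ≤ (x + 1) ^ s / s - (x + 1) ^ (s - 1) := by
      rw [hsub, div_le_iff₀ hs]
      calc x ^ s ≤ _ := hpow
        _ = _ := by field_simp; ring
    linarith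

/-- One step of the variance recursion preserves the bound `A * (n + 1) ^ (-p)`. -/
theorem variance_recursion_step {A a p x v w : ℝ} (hA : 0 ≤ A) (hp1 : p ≤ 1)
    (hx : 0 < x) (ha : 1 / (x + 1) ≤ a) (ha1 : a ≤ 1) (hv : v ≤ A * x ^ (-p))
    (hw : a * w ≤ A * (x + 1) ^ (-p)) :
    (1 - a) ^ 2 * v + a ^ 2 * w ≤ A * (x + 1) ^ (-p) := by
  have hx1 : 0 < x + 1 := by positivity
  have ha0 : 0 ≤ a := le_trans (by positivity) ha
  have hratio : (1 - a) * x ^ (-p) ≤ (x + 1) ^ (-p) := by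
    have h1 : 1 - a ≤ x / (x + 1) := by
      have : x / (x + 1) = 1 - 1 / (x + 1) := by field_simp; ring
      linarith
    have h2 : x / (x + 1) ≤ (x / (x + 1)) ^ p :=
      Real.self_le_rpow_of_le_one (by positivity) (by rw [div_le_one hx1]; linarith) hp1
    calc (1 - a) * x ^ (-p) ≤ (x / (x + 1)) ^ p * x ^ (-p) := by
          gcongr
          exact h1.trans h2
      _ = (x + 1) ^ (-p) := by
          rw [Real.div_rpow hx.le hx1.le, Real.rpow_neg hx.le, Real.rpow_neg hx1.le]
          have := (Real.rpow_pos_of_pos hx p).ne'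
          field_simp
  calc (1 - a) ^ 2 * v + a ^ 2 * w
      ≤ (1 - a) ^ 2 * (A * x ^ (-p)) + a * (a * w) := by
        rw [sq a, mul_assoc]
        gcongr
    _ = (1 - a) * A * ((1 - a) * x ^ (-p)) + a * (a * w) := by ring
    _ ≤ (1 - a) * A * (x + 1) ^ (-p) + a * (A * (x + 1) ^ (-p)) := by
        have : 0 ≤ (1 - a) * A := mul_nonneg (by linarith) hA
        gcongr
    _ = A * (x + 1) ^ (-p) := by ring

/-- With α_n = 1/(n+1)^b (α_0 = 0), b ∈ (4/5, 1],
τ_n = Σ_{k=1}^n α_k(1 − α_k), α_{k,n} = α_k ∏_{j=k+1}^n (1 − α_j), and {M_n} an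
ℝ^d-valued martingale difference sequence with E[‖M_n‖₂²] ≤ C² τ_n², the
nondecreasing sequence Σ_{k=1}^n α_k ‖Σ_{i=1}^{k−1} α_{i,k−1} M_i‖₂ converges
to a finite limit almost surely. -/
theorem weighted_martingale_sum_converges {d : ℕ} (b : ℝ) (hb : 4/5 < b ∧ b ≤ 1)
    (α τ : ℕ → ℝ) (αp : ℕ → ℕ → ℝ) (hα0 : α 0 = 0)
    (hα : ∀ n ≥ 1, α n = 1 / ((n : ℝ) + 1) ^ b)
    (hτ : ∀ n, τ n = ∑ k ∈ Finset.Icc 1 n, α k * (1 - α k))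
    (hαp : ∀ k n, αp k n = α k * ∏ j ∈ Finset.Icc (k + 1) n, (1 - α j))
    {Ω : Type*} {m0 : MeasurableSpace Ω} (μ : Measure Ω) [IsProbabilityMeasure μ]
    (ℱ : Filtration ℕ m0)
    (M : ℕ → Ω → EuclideanSpace ℝ (Fin d))
    (hadapt : ∀ n, StronglyMeasurable[ℱ n] (M n))
    (hint : ∀ n, MemLp (M n) 2 μ)
    (hmds : ∀ n, μ[M (n + 1) | ℱ n] =ᵐ[μ] 0)
    (C : ℝ)
    (hmom : ∀ n ≥ 1, ∫ ω, ‖M n ω‖ ^ 2 ∂μ ≤ C ^ 2 * τ n ^ 2) :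
    ∀ᵐ ω ∂μ, ∃ L : ℝ,
      Tendsto (fun n => ∑ k ∈ Finset.Icc 1 n,
        α k * ‖∑ i ∈ Finset.Icc 1 (k - 1), αp i (k - 1) • M i ω‖) atTop (nhds L) := by
  obtain ⟨hb1, hb2⟩ := hb
  have hαle : ∀ n, α n ≤ 1 := by
    intro n
    rcases Nat.eq_zero_or_pos n with rfl | hn
    · simp [hα0]
    · rw [hα n hn]
      exact (div_le_one (by positivity)).2 (Real.one_le_rpow (by simp) (by linarith))
  have hαrpow : ∀ n ≥ 1, α n = ((n : ℝ) + 1) ^ (-b) := fun n hn => by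
    rw [hα n hn, Real.rpow_neg (by positivity), one_div]
  have hαnonneg : ∀ n ≥ 1, 0 ≤ α n := fun n hn => by
    rw [hα n hn]
    positivity
  -- Since `b > 4/5`, these exponents satisfy `s < 1/5`, `p = b - 2 * s` and `b + p / 2 > 1`.
  obtain ⟨s, hs⟩ : ∃ s : ℝ, s = 3 / 5 - b / 2 := ⟨_, rfl⟩
  obtain ⟨p, hp⟩ : ∃ p : ℝ, p = 2 * b - 6 / 5 := ⟨_, rfl⟩
  have hτnonneg : ∀ n, 0 ≤ τ n := fun n => by
    rw [hτ]
    refine Finset.sum_nonneg fun k hk => ?_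
    have hk1 := (Finset.mem_Icc.1 hk).1
    exact mul_nonneg (hαnonneg k hk1) (sub_nonneg.2 (hαle k))
  have hτle : ∀ n, τ n ≤ ((n : ℝ) + 1) ^ s / s := by
    intro n
    rw [hτ]
    refine le_trans (Finset.sum_le_sum fun k hk => ?_)
      (sum_Icc_rpow_sub_one_le (s := s) (by linarith) (by linarith) n)
    have hk1 := (Finset.mem_Icc.1 hk).1
    calc α k * (1 - α k) ≤ α k :=
          mul_le_of_le_one_right (hαnonneg k hk1) (by linarith [hαnonneg k hk1])
      _ ≤ ((k : ℝ) + 1) ^ (s - 1) := by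
          rw [hαrpow k hk1]
          exact Real.rpow_le_rpow_of_exponent_le (by simp) (by linarith)
  set A : ℝ := C ^ 2 / s ^ 2 with hA
  have hA0 : 0 ≤ A := by positivity
  have hmomle : ∀ n ≥ 1, α n * ∫ ω, ‖M n ω‖ ^ 2 ∂μ ≤ A * ((n : ℝ) + 1) ^ (-p) := by
    intro n hn
    have hn0 : 0 < (n : ℝ) + 1 := by positivity
    calc α n * ∫ ω, ‖M n ω‖ ^ 2 ∂μ
        ≤ α n * (C ^ 2 * (((n : ℝ) + 1) ^ s / s) ^ 2) := by
          have h1 := hαnonneg n hn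
          have h2 := hτnonneg n
          refine mul_le_mul_of_nonneg_left ((hmom n hn).trans ?_) h1
          gcongr
          exact hτle n
      _ = A * (((n : ℝ) + 1) ^ (-b) * (((n : ℝ) + 1) ^ s * ((n : ℝ) + 1) ^ s)) := by
          rw [hαrpow n hn, hA]
          ring
      _ = A * ((n : ℝ) + 1) ^ (-p) := by
          rw [← Real.rpow_add hn0, ← Real.rpow_add hn0]
          congr 2
          rw [hs, hp]
          ring
  set X : ℕ → Ω → EuclideanSpace ℝ (Fin d) :=
    fun n ω => ∑ i ∈ Finset.Icc 1 n, αp i n • M i ω with hX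
  have hXsucc : ∀ n, X (n + 1) =
      fun ω => (1 - α (n + 1)) • X n ω + α (n + 1) • M (n + 1) ω := by
    intro n
    funext ω
    simp only [hX]
    rw [Finset.sum_Icc_succ_top (by omega), Finset.smul_sum]
    congr 1
    · refine Finset.sum_congr rfl fun i hi => ?_
      have hi2 := (Finset.mem_Icc.1 hi).2
      rw [smul_smul, hαp, hαp, Finset.prod_Icc_succ_top (by omega)]
      congr 1
      ring
    · rw [hαp, Finset.Icc_eq_empty (by omega)]
      simp
  have hXmeas : ∀ n, StronglyMeasurable[ℱ n] (X n) := fun n =>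
    Finset.stronglyMeasurable_fun_sum _ fun i hi =>
      ((hadapt i).mono (ℱ.mono (Finset.mem_Icc.1 hi).2)).fun_const_smul _
  have hXmem : ∀ n, MemLp (X n) 2 μ := fun n =>
    memLp_finsetSum _ fun i _ => by exact (hint i).const_smul (αp i n)
  have hvar : ∀ n, ∫ ω, ‖X n ω‖ ^ 2 ∂μ ≤ A * ((n : ℝ) + 1) ^ (-p) := by
    intro n
    induction n with
    | zero => simpa [hX] using hA0
    | succ n ih =>
      rw [hXsucc n, integral_norm_sq_smul_add_smul_of_condExp_eq_zero (ℱ.le n) (hXmeas n)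
        (hXmem n) (hint (n + 1)) (hmds n)]
      have hw := hmomle (n + 1) (by omega)
      push_cast at hw ⊢
      refine variance_recursion_step hA0 (by linarith) (by positivity) ?_
        (hαle (n + 1)) ih hw
      rw [hα (n + 1) (by omega)]
      push_cast
      gcongr
      exact Real.rpow_le_self_of_one_le (by linarith [n.cast_nonneg (α := ℝ)]) hb2
  have hmean : ∀ n, ∫ ω, ‖α (n + 1) • X n ω‖ ∂μ ≤
      (1 + A) * ((n + 1 : ℕ) : ℝ) ^ (-(b + p / 2)) := by
    intro n
    have hn0 : 0 < (n : ℝ) + 1 := by positivity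
    have hα1 := hαnonneg (n + 1) (by omega)
    have hαle' : α (n + 1) ≤ ((n : ℝ) + 1) ^ (-b) := by
      rw [hαrpow (n + 1) (by omega)]
      exact Real.rpow_le_rpow_of_nonpos hn0 (by push_cast; linarith) (by linarith)
    have hr : 0 < ((n : ℝ) + 1) ^ (-(p / 2)) := by positivity
    have hsplit : ((n : ℝ) + 1) ^ (-p) =
        ((n : ℝ) + 1) ^ (-(p / 2)) * ((n : ℝ) + 1) ^ (-(p / 2)) := by
      rw [← Real.rpow_add hn0]
      congr 1
      ring
    simp_rw [norm_smul, Real.norm_of_nonneg hα1]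
    rw [integral_const_mul]
    calc α (n + 1) * ∫ ω, ‖X n ω‖ ∂μ
        ≤ ((n : ℝ) + 1) ^ (-b) * ((1 + A) * ((n : ℝ) + 1) ^ (-(p / 2))) := by
          refine mul_le_mul hαle' ?_ (integral_nonneg fun _ => norm_nonneg _) (by positivity)
          refine (integral_norm_le_add_integral_norm_sq_div (hXmem n) hr).trans ?_
          rw [add_mul, one_mul]
          gcongr
          rw [div_le_iff₀ hr, mul_assoc, ← hsplit]
          exact hvar n
      _ = (1 + A) * ((n + 1 : ℕ) : ℝ) ^ (-(b + p / 2)) := by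
          push_cast
          rw [mul_left_comm, ← Real.rpow_add hn0, neg_add]
  have hsum : Summable fun n => ∫ ω, ‖α (n + 1) • X n ω‖ ∂μ := by
    refine Summable.of_nonneg_of_le (fun n => integral_nonneg fun _ => norm_nonneg _) hmean
      (Summable.mul_left _ ?_)
    exact (summable_nat_add_iff 1 (f := fun n : ℕ => (n : ℝ) ^ (-(b + p / 2)))).2
      (Real.summable_nat_rpow.2 (by linarith))
  filter_upwards [ae_summable_norm_of_summable_integral_norm
    (fun n => ((hXmem n).integrable one_le_two).smul (α (n + 1))) hsum] with ω hω
  refine ⟨_, hω.hasSum.tendsto_sum_nat.congr fun n => ?_⟩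
  have hshift := Finset.sum_Ico_add' (fun k => α k * ‖X (k - 1) ω‖) 0 n 1
  rw [zero_add, ← Finset.range_eq_Ico, Finset.Ico_add_one_right_eq_Icc] at hshift
  rw [← hshift]
  refine Finset.sum_congr rfl fun k _ => ?_
  rw [Pi.smul_apply, norm_smul, Real.norm_of_nonneg (hαnonneg (k + 1) (by omega)),
    Nat.add_sub_cancel]
end

section
/- Let b ∈ (4/5, 1], α_n = 1/(n+1)^b, τ_n = Σ_{k=1}^n α_k(1 − α_k), and α_{k,n} = α_k ∏_{j=k+1}^n (1 − α_j). Let {M_n}_{n≥1} be an ℝ^d-valued martingale difference sequence with respect to a filtration (ℱ_n) satisfying E[‖M_n‖₂²] ≤ C² τ_n² for a deterministic constant C. Then for every n ≥ 1, E[‖Σ_{i=1}^n α_{i,n} M_i‖₂] ≤ C τ_n √(α_{n+1}). -/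
open MeasureTheory Filter

/-- `log m ≤ m / 2` for positive `m`. -/
lemma log_le_half_self {m : ℝ} (hm : 0 < m) : Real.log m ≤ m / 2 := by
  have h := Real.log_le_sub_one_of_pos (half_pos hm)
  rw [Real.log_div hm.ne' two_ne_zero] at h
  linarith [Real.log_two_lt_d9]

/-- The exponent gap `1 - b` is bounded below as soon as `m ^ b < (m - 1) (1 + 1 / m) ^ b`. -/
lemma two_lt_one_sub_mul_cube {b m : ℝ} (hb0 : 0 ≤ b) (hb1 : b ≤ 1) (hm : 1 ≤ m)
    (h : m ^ b < (m - 1) * (1 + 1 / m) ^ b) : 2 < (1 - b) * m ^ 3 := by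
  have hm0 : 0 < m := by linarith
  have hr : (1 + 1 / m) ^ b ≤ 1 + b * (1 / m) :=
    rpow_one_add_le_one_add_mul_self (by linarith [one_div_pos.2 hm0]) hb0 hb1
  have hx : m * (1 - (1 - b) * (m / 2)) ≤ m ^ b := by
    have h1 : m ^ b = m * Real.exp (-((1 - b) * Real.log m)) := by
      rw [Real.rpow_def_of_pos hm0]
      nth_rewrite 2 [← Real.exp_log hm0]
      rw [← Real.exp_add]
      ring_nf
    rw [h1]
    have h2 := Real.add_one_le_exp (-((1 - b) * Real.log m))
    have h3 := mul_le_mul_of_nonneg_left (log_le_half_self hm0) (sub_nonneg.2 hb1)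
    exact mul_le_mul_of_nonneg_left (by linarith) hm0.le
  have h4 : m * (1 - (1 - b) * (m / 2)) < (m - 1) * (1 + b * (1 / m)) :=
    hx.trans_lt (h.trans_le (mul_le_mul_of_nonneg_left hr (by linarith)))
  have h5 := mul_lt_mul_of_pos_right h4 hm0
  have h6 : (m - 1) * (1 + b * (1 / m)) * m = (m - 1) * (m + b) := by field_simp
  rw [h6] at h5
  nlinarith [mul_nonneg (sub_nonneg.2 hb1) (sub_nonneg.2 hm)]

/-- Either the crude bound `n αₙ² ≤ αₙ₊₁` holds (with `m = n + 1`), or the one-step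
recursion `a ↦ (1 - a)² a + a²` maps `m ^ (-b)` below `(m + 1) ^ (-b)`. -/
lemma rpow_dichotomy {b m : ℝ} (hb : 4 / 5 < b) (hb1 : b ≤ 1) (hm : 3 ≤ m) :
    (m - 1) * (m + 1) ^ b ≤ (m ^ b) ^ 2 ∨
      ((m ^ b) ^ 2 - m ^ b + 1) * (m + 1) ^ b ≤ (m ^ b) ^ 3 := by
  have hm0 : 0 < m := by linarith
  have hb0 : 0 ≤ b := by linarith
  have hz : (m + 1) ^ b = m ^ b * (1 + 1 / m) ^ b := by
    rw [← Real.mul_rpow hm0.le (by positivity)]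
    congr 1
    field_simp
  have hx2 : 2 ≤ m ^ b := by
    calc (2 : ℝ) = ((2 : ℝ) ^ (5 / 4 : ℝ)) ^ (4 / 5 : ℝ) := by
          rw [← Real.rpow_mul (by norm_num)]; norm_num
      _ ≤ 3 ^ (4 / 5 : ℝ) := by
          refine Real.rpow_le_rpow (by positivity) ?_ (by norm_num)
          refine le_of_pow_le_pow_left₀ (n := 4) (by norm_num) (by norm_num) ?_
          rw [← Real.rpow_natCast, ← Real.rpow_mul (by norm_num)]
          norm_num
      _ ≤ m ^ (4 / 5 : ℝ) := Real.rpow_le_rpow (by norm_num) hm (by norm_num)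
      _ ≤ m ^ b := Real.rpow_le_rpow_of_exponent_le (by linarith) hb.le
  have hr : (1 + 1 / m) ^ b ≤ 1 + b * (1 / m) :=
    rpow_one_add_le_one_add_mul_self (by linarith [one_div_pos.2 hm0]) hb0 hb1
  have hr1 : 1 ≤ (1 + 1 / m) ^ b :=
    Real.one_le_rpow (by linarith [one_div_pos.2 hm0]) hb0
  have hgap := two_lt_one_sub_mul_cube hb0 hb1 (by linarith : 1 ≤ m)
  rw [hz]
  generalize m ^ b = x at *
  generalize (1 + 1 / m) ^ b = r at *
  have hx0 : 0 < x := by linarith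
  rcases le_or_gt ((m - 1) * r) x with h | h
  · left
    nlinarith
  right
  have hgap := hgap h
  have hr2 : r ≤ 1 + 1 / m - 2 / m ^ 4 := by
    refine hr.trans ?_
    have : 2 / m ^ 4 ≤ (1 - b) / m := by
      rw [div_le_div_iff₀ (by positivity) hm0]
      nlinarith
    have e : b * (1 / m) = 1 / m - (1 - b) / m := by ring
    linarith
  -- the convex quadratic `p² r² - (p² + p) r + 1`, `p = m - 1`, is negative on the range of `r`
  have hq : (m - 1) ^ 2 * r ^ 2 - ((m - 1) ^ 2 + (m - 1)) * r + 1 ≤ 0 := by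
    set s := 1 + 1 / m - 2 / m ^ 4 with hs
    have hs1 : 1 < s := by
      have : 2 / m ^ 4 < 1 / m := by
        rw [div_lt_div_iff₀ (by positivity) hm0]
        have : 2 < m ^ 3 := by nlinarith [pow_le_pow_left₀ (by norm_num) hm 3]
        nlinarith
      linarith
    have hqs : (m - 1) ^ 2 * s ^ 2 - ((m - 1) ^ 2 + (m - 1)) * s + 1 ≤ 0 := by
      have e : (m - 1) ^ 2 * s ^ 2 - ((m - 1) ^ 2 + (m - 1)) * s + 1 =
          -(((m - 1) * m * (m ^ 4 + m ^ 3 - 2) * m ^ 4 - (m - 1) ^ 2 * (m ^ 4 + m ^ 3 - 2) ^ 2 -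
            m ^ 8) / m ^ 8) := by
        rw [hs]
        field_simp
        ring
      rw [e, neg_nonpos]
      refine div_nonneg ?_ (by positivity)
      obtain ⟨k, hk, rfl⟩ : ∃ k, 0 ≤ k ∧ m = 3 + k := ⟨m - 3, by linarith, by ring⟩
      ring_nf
      positivity
    have h1 : 0 ≤ (s - r) * (m - 2) := mul_nonneg (by linarith) (by linarith)
    have h2 := mul_nonneg (sub_nonneg.2 hr1) (neg_nonneg.2 hqs)
    have h3 : 0 ≤ (m - 1) ^ 2 * ((s - r) * (r - 1) * (s - 1)) :=
      mul_nonneg (sq_nonneg _) (mul_nonneg (mul_nonneg (by linarith) (by linarith)) (by linarith))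
    refine nonpos_of_mul_nonpos_right (a := s - 1) ?_ (by linarith)
    linarith
  have hmono : (x ^ 2 - x + 1) * r ≤ x ^ 2 := by
    have hp : 0 < (m - 1) * r := hx0.trans h
    set y := (m - 1) * r with hy
    have h1 : (x ^ 2 - x + 1) * y ^ 2 ≤ (y ^ 2 - y + 1) * x ^ 2 := by
      -- difference is `(y - x) (x y - x - y)`
      nlinarith [mul_nonneg (sub_nonneg.2 h.le) (by nlinarith : 0 ≤ x * y - x - y)]
    have h2 : (y ^ 2 - y + 1) * r ≤ y ^ 2 := by
      have : r * ((m - 1) ^ 2 * r ^ 2 - ((m - 1) ^ 2 + (m - 1)) * r + 1) ≤ 0 :=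
        mul_nonpos_of_nonneg_of_nonpos (by linarith) hq
      rw [hy]
      nlinarith
    refine le_of_mul_le_mul_right ?_ (pow_pos hp 2)
    calc (x ^ 2 - x + 1) * r * y ^ 2 = (x ^ 2 - x + 1) * y ^ 2 * r := by ring
      _ ≤ (y ^ 2 - y + 1) * x ^ 2 * r := mul_le_mul_of_nonneg_right h1 (by linarith)
      _ = (y ^ 2 - y + 1) * r * x ^ 2 := by ring
      _ ≤ y ^ 2 * x ^ 2 := mul_le_mul_of_nonneg_right h2 (sq_nonneg x)
      _ = x ^ 2 * y ^ 2 := by ring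
  calc (x ^ 2 - x + 1) * (x * r) = (x ^ 2 - x + 1) * r * x := by ring
    _ ≤ x ^ 2 * x := mul_le_mul_of_nonneg_right hmono hx0.le
    _ = x ^ 3 := by ring

/-- `∑ₖ αₖ,ₙ² ≤ αₙ₊₁` for the step sizes `αₙ = (n + 1) ^ (-b)`. -/
lemma sum_sq_weights_le {b : ℝ} (hb : 4 / 5 < b) (hb1 : b ≤ 1) {α : ℕ → ℝ}
    (hα : ∀ n ≥ 1, α n = 1 / ((n : ℝ) + 1) ^ b) {n : ℕ} (hn : 1 ≤ n) :
    ∑ k ∈ Finset.Icc 1 n, (α k * ∏ j ∈ Finset.Icc (k + 1) n, (1 - α j)) ^ 2 ≤ α (n + 1) := by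
  have hb0 : 0 ≤ b := by linarith
  have hαpos : ∀ n ≥ 1, 0 < α n := fun n hn ↦ by rw [hα n hn]; positivity
  have hαle : ∀ n ≥ 1, α n ≤ 1 := fun n hn ↦ by
    rw [hα n hn]
    exact div_le_one_of_le₀ (Real.one_le_rpow (by linarith [n.cast_nonneg (α := ℝ)]) hb0)
      (by positivity)
  have hstep : ∀ n ≥ 1, α n * (1 - α (n + 1)) ≤ α (n + 1) := fun n hn ↦ by
    have hsub : ((n : ℝ) + 1 + 1) ^ b ≤ ((n : ℝ) + 1) ^ b + 1 := by
      simpa using Real.rpow_add_le_add_rpow (by positivity : (0 : ℝ) ≤ (n : ℝ) + 1)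
        zero_le_one hb0 hb1
    rw [hα n hn, hα (n + 1) (by omega)]
    push_cast
    have h1 : 0 < ((n : ℝ) + 1) ^ b := by positivity
    have h2 : 0 < ((n : ℝ) + 1 + 1) ^ b := by positivity
    generalize ((n : ℝ) + 1) ^ b = x at *
    generalize ((n : ℝ) + 1 + 1) ^ b = y at *
    have e : 1 / x * (1 - 1 / y) = ((y - 1) / x) * (1 / y) := by field_simp
    rw [e]
    refine mul_le_of_le_one_left (by positivity) ?_
    rw [div_le_one h1]
    linarith
  set w : ℕ → ℕ → ℝ := fun k n ↦ α k * ∏ j ∈ Finset.Icc (k + 1) n, (1 - α j) with hw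
  have hwself : ∀ n, w n n = α n := fun n ↦ by simp [hw]
  have hwsucc : ∀ k n, k ≤ n → w k (n + 1) = w k n * (1 - α (n + 1)) := fun k n hkn ↦ by
    simp only [hw]
    rw [Finset.prod_Icc_succ_top (by omega), mul_assoc]
  have hwbound : ∀ k ≥ 1, ∀ n ≥ k, 0 ≤ w k n ∧ w k n ≤ α n := fun k hk n hkn ↦ by
    induction n, hkn using Nat.le_induction with
    | base => rw [hwself]; exact ⟨(hαpos k hk).le, le_rfl⟩
    | succ n hkn ih =>
      have h0 : 0 ≤ 1 - α (n + 1) := sub_nonneg.2 (hαle _ (by omega))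
      rw [hwsucc k n hkn]
      exact ⟨mul_nonneg ih.1 h0,
        (mul_le_mul_of_nonneg_right ih.2 h0).trans (hstep n (by omega))⟩
  have hcrude : ∀ n : ℕ, ∑ k ∈ Finset.Icc 1 n, w k n ^ 2 ≤ n * α n ^ 2 := fun n ↦ by
    calc ∑ k ∈ Finset.Icc 1 n, w k n ^ 2 ≤ ∑ _k ∈ Finset.Icc 1 n, α n ^ 2 := by
          refine Finset.sum_le_sum fun k hk ↦ ?_
          obtain ⟨h1, h2⟩ := Finset.mem_Icc.1 hk
          obtain ⟨h3, h4⟩ := hwbound k h1 n h2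
          exact pow_le_pow_left₀ h3 h4 2
      _ = n * α n ^ 2 := by simp
  change ∑ k ∈ Finset.Icc 1 n, w k n ^ 2 ≤ α (n + 1)
  induction n, hn using Nat.le_induction with
  | base =>
    refine (hcrude 1).trans ?_
    rw [hα 1 le_rfl, hα 2 (by omega)]
    have h : (3 : ℝ) ^ b ≤ (2 ^ b) ^ 2 := by
      rw [pow_two, ← Real.mul_rpow (by norm_num) (by norm_num)]
      exact Real.rpow_le_rpow (by norm_num) (by norm_num) hb0
    norm_num
    exact inv_anti₀ (by positivity) h
  | succ n hn ih =>
    have hm : (3 : ℝ) ≤ (n : ℝ) + 2 := by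
      have : (1 : ℝ) ≤ n := by exact_mod_cast hn
      linarith
    have e1 : α (n + 1) = 1 / ((n : ℝ) + 2) ^ b := by
      rw [hα (n + 1) (by omega)]; push_cast; ring_nf
    have e2 : α (n + 1 + 1) = 1 / ((n : ℝ) + 2 + 1) ^ b := by
      rw [hα (n + 1 + 1) (by omega)]; push_cast; ring_nf
    have hx : 0 < ((n : ℝ) + 2) ^ b := by positivity
    have hz : 0 < ((n : ℝ) + 2 + 1) ^ b := by positivity
    rcases rpow_dichotomy hb hb1 hm with h | h
    · refine (hcrude (n + 1)).trans ?_
      rw [e1, e2, div_pow, one_pow, mul_one_div, div_le_div_iff₀ (by positivity) hz]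
      push_cast
      linarith
    · have hrec : ∑ k ∈ Finset.Icc 1 (n + 1), w k (n + 1) ^ 2 =
          (∑ k ∈ Finset.Icc 1 n, w k n ^ 2) * (1 - α (n + 1)) ^ 2 + α (n + 1) ^ 2 := by
        rw [Finset.sum_Icc_succ_top (by omega), hwself, Finset.sum_mul]
        congr 1
        refine Finset.sum_congr rfl fun k hk ↦ ?_
        rw [hwsucc k n (Finset.mem_Icc.1 hk).2, mul_pow]
      rw [hrec]
      refine (add_le_add_left (mul_le_mul_of_nonneg_right ih (sq_nonneg _)) _).trans ?_
      rw [e1, e2]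
      generalize ((n : ℝ) + 2) ^ b = x at *
      generalize ((n : ℝ) + 2 + 1) ^ b = z at *
      have e3 : 1 / x * (1 - 1 / x) ^ 2 + (1 / x) ^ 2 = (x ^ 2 - x + 1) / x ^ 3 := by
        field_simp
        ring
      rw [e3, div_le_div_iff₀ (by positivity) hz]
      linarith

/-- Orthogonality of martingale differences. -/
lemma integral_norm_sq_sum_martingaleDifference {E Ω : Type*} [NormedAddCommGroup E]
    [InnerProductSpace ℝ E] [CompleteSpace E] {m0 : MeasurableSpace Ω} (μ : Measure Ω)
    [IsFiniteMeasure μ] (ℱ : Filtration ℕ m0) (M : ℕ → Ω → E)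
    (hadapt : ∀ n, StronglyMeasurable[ℱ n] (M n)) (hint : ∀ n, MemLp (M n) 2 μ)
    (hmds : ∀ n, μ[M (n + 1) | ℱ n] =ᵐ[μ] 0) (c : ℕ → ℝ) (n : ℕ) :
    ∫ ω, ‖∑ i ∈ Finset.Icc 1 n, c i • M i ω‖ ^ 2 ∂μ =
      ∑ i ∈ Finset.Icc 1 n, c i ^ 2 * ∫ ω, ‖M i ω‖ ^ 2 ∂μ := by
  induction n with
  | zero => simp
  | succ n ih =>
    set S : Ω → E := fun ω ↦ ∑ i ∈ Finset.Icc 1 n, c i • M i ω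
    have hSm : StronglyMeasurable[ℱ n] S :=
      Finset.stronglyMeasurable_fun_sum _ fun i hi ↦
        ((hadapt i).mono (ℱ.mono (Finset.mem_Icc.1 hi).2)).const_smul (c i)
    have hSL : MemLp S 2 μ := memLp_finsetSum _ fun i _ ↦ (hint i).const_smul (c i)
    have hinner : Integrable (fun ω ↦ inner ℝ (S ω) (M (n + 1) ω)) μ := by
      have hp : Integrable (fun ω ↦ ‖S ω‖ * ‖M (n + 1) ω‖) μ :=
        hSL.norm.integrable_mul (hint (n + 1)).norm
      refine hp.mono' (hSL.1.inner (hint (n + 1)).1) (ae_of_all _ fun ω ↦ ?_)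
      exact norm_inner_le_norm _ _
    have horth : ∫ ω, inner ℝ (S ω) (M (n + 1) ω) ∂μ = 0 := by
      have h := condExp_bilin_of_stronglyMeasurable_left (innerSL ℝ) hSm hinner
        ((hint (n + 1)).integrable one_le_two)
      have h0 : μ[fun ω ↦ inner ℝ (S ω) (M (n + 1) ω) | ℱ n] =ᵐ[μ] 0 := by
        refine h.trans ?_
        filter_upwards [hmds n] with ω hω
        simp [hω]
      rw [← integral_condExp (ℱ.le n), integral_congr_ae h0]
      simp
    have hexp : ∀ ω, ‖∑ i ∈ Finset.Icc 1 (n + 1), c i • M i ω‖ ^ 2 =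
        ‖S ω‖ ^ 2 + 2 * c (n + 1) * inner ℝ (S ω) (M (n + 1) ω) +
          c (n + 1) ^ 2 * ‖M (n + 1) ω‖ ^ 2 := fun ω ↦ by
      rw [Finset.sum_Icc_succ_top (by omega), norm_add_sq_real, inner_smul_right, norm_smul,
        mul_pow, Real.norm_eq_abs, sq_abs]
      ring
    have hS2 : Integrable (fun ω ↦ ‖S ω‖ ^ 2) μ := hSL.integrable_norm_pow two_ne_zero
    have hM2 : Integrable (fun ω ↦ ‖M (n + 1) ω‖ ^ 2) μ :=
      (hint (n + 1)).integrable_norm_pow two_ne_zero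
    simp_rw [hexp]
    have hSI : Integrable
        (fun ω ↦ ‖S ω‖ ^ 2 + 2 * c (n + 1) * inner ℝ (S ω) (M (n + 1) ω)) μ :=
      hS2.add (hinner.const_mul _)
    rw [integral_add hSI (hM2.const_mul _), integral_add hS2 (hinner.const_mul _), integral_const_mul, integral_const_mul, horth, ih,
      Finset.sum_Icc_succ_top (by omega)]
    ring

/-- On a probability space the `L¹` norm is bounded by the `L²` norm. -/
lemma sq_integral_norm_le {E Ω : Type*} [NormedAddCommGroup E] {m0 : MeasurableSpace Ω}
    (μ : Measure Ω) [IsProbabilityMeasure μ] {X : Ω → E} (hX : MemLp X 2 μ) :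
    (∫ ω, ‖X ω‖ ∂μ) ^ 2 ≤ ∫ ω, ‖X ω‖ ^ 2 ∂μ := by
  have h := ProbabilityTheory.variance_nonneg (fun ω ↦ ‖X ω‖) μ
  rw [ProbabilityTheory.variance_eq_sub hX.norm] at h
  simpa using h

/-- With α_n = 1/(n+1)^b (α_0 = 0), b ∈ (4/5, 1],
τ_n = Σ_{k=1}^n α_k(1 − α_k), α_{k,n} = α_k ∏_{j=k+1}^n (1 − α_j), and {M_n} an
ℝ^d-valued martingale difference sequence with E[‖M_n‖₂²] ≤ C² τ_n², for every
n ≥ 1: E[‖Σ_{i=1}^n α_{i,n} M_i‖₂] ≤ C τ_n √α_{n+1}. -/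
theorem weighted_martingale_expectation_rate {d : ℕ} (b : ℝ) (hb : 4/5 < b ∧ b ≤ 1)
    (α τ : ℕ → ℝ) (αp : ℕ → ℕ → ℝ) (hα0 : α 0 = 0)
    (hα : ∀ n ≥ 1, α n = 1 / ((n : ℝ) + 1) ^ b)
    (hτ : ∀ n, τ n = ∑ k ∈ Finset.Icc 1 n, α k * (1 - α k))
    (hαp : ∀ k n, αp k n = α k * ∏ j ∈ Finset.Icc (k + 1) n, (1 - α j))
    {Ω : Type*} {m0 : MeasurableSpace Ω} (μ : Measure Ω) [IsProbabilityMeasure μ]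
    (ℱ : Filtration ℕ m0)
    (M : ℕ → Ω → EuclideanSpace ℝ (Fin d))
    (hadapt : ∀ n, StronglyMeasurable[ℱ n] (M n))
    (hint : ∀ n, MemLp (M n) 2 μ)
    (hmds : ∀ n, μ[M (n + 1) | ℱ n] =ᵐ[μ] 0)
    (C : ℝ) (hC : 0 ≤ C)
    (hmom : ∀ n ≥ 1, ∫ ω, ‖M n ω‖ ^ 2 ∂μ ≤ C ^ 2 * τ n ^ 2) :
    ∀ n ≥ 1, ∫ ω, ‖∑ i ∈ Finset.Icc 1 n, αp i n • M i ω‖ ∂μ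
      ≤ C * τ n * Real.sqrt (α (n + 1)) := by
  intro n hn
  have hα01 : ∀ k ≥ 1, 0 ≤ α k * (1 - α k) := fun k hk ↦ by
    have h1 : 1 ≤ ((k : ℝ) + 1) ^ b :=
      Real.one_le_rpow (by linarith [k.cast_nonneg (α := ℝ)]) (by linarith [hb.1])
    rw [hα k hk]
    exact mul_nonneg (by positivity) (sub_nonneg.2 (div_le_one_of_le₀ h1 (by positivity)))
  have hτ0 : ∀ k, 0 ≤ τ k := fun k ↦ by
    rw [hτ]
    exact Finset.sum_nonneg fun i hi ↦ hα01 i (Finset.mem_Icc.1 hi).1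
  have hτmono : ∀ k ≤ n, τ k ≤ τ n := fun k hk ↦ by
    rw [hτ, hτ]
    exact Finset.sum_le_sum_of_subset_of_nonneg (Finset.Icc_subset_Icc_right hk)
      fun i hi _ ↦ hα01 i (Finset.mem_Icc.1 hi).1
  have hα1 : 0 ≤ α (n + 1) := by rw [hα (n + 1) (by omega)]; positivity
  have hL : MemLp (fun ω ↦ ∑ i ∈ Finset.Icc 1 n, αp i n • M i ω) 2 μ :=
    memLp_finsetSum _ fun i _ ↦ (hint i).const_smul (αp i n)
  have hsum : ∑ i ∈ Finset.Icc 1 n, αp i n ^ 2 ≤ α (n + 1) := by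
    simp_rw [hαp]
    exact sum_sq_weights_le hb.1 hb.2 hα hn
  refine le_of_sq_le_sq ?_ (mul_nonneg (mul_nonneg hC (hτ0 n)) (Real.sqrt_nonneg _))
  calc (∫ ω, ‖∑ i ∈ Finset.Icc 1 n, αp i n • M i ω‖ ∂μ) ^ 2
      ≤ ∫ ω, ‖∑ i ∈ Finset.Icc 1 n, αp i n • M i ω‖ ^ 2 ∂μ := sq_integral_norm_le μ hL
    _ = ∑ i ∈ Finset.Icc 1 n, αp i n ^ 2 * ∫ ω, ‖M i ω‖ ^ 2 ∂μ :=
        integral_norm_sq_sum_martingaleDifference μ ℱ M hadapt hint hmds (αp · n) n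
    _ ≤ ∑ i ∈ Finset.Icc 1 n, αp i n ^ 2 * (C ^ 2 * τ n ^ 2) := by
        refine Finset.sum_le_sum fun i hi ↦ mul_le_mul_of_nonneg_left ?_ (sq_nonneg _)
        obtain ⟨h1, h2⟩ := Finset.mem_Icc.1 hi
        exact (hmom i h1).trans (mul_le_mul_of_nonneg_left
          (pow_le_pow_left₀ (hτ0 i) (hτmono i h2) 2) (sq_nonneg C))
    _ = (∑ i ∈ Finset.Icc 1 n, αp i n ^ 2) * (C ^ 2 * τ n ^ 2) := by rw [Finset.sum_mul]
    _ ≤ α (n + 1) * (C ^ 2 * τ n ^ 2) := mul_le_mul_of_nonneg_right hsum (by positivity)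
    _ = (C * τ n * Real.sqrt (α (n + 1))) ^ 2 := by
        rw [mul_pow, mul_pow, Real.sq_sqrt hα1]
        ring
end
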